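/- arXiv:math/0508039 — 2 statements merged into one kernel-verified Lean document; each statement's English description precedes it below -/
import Mathlib

section
/- Let a, b ∈ ℝ, let A_{i,j} be polynomials of total degree at most 2 and B_i polynomials of total degree at most 1 with B_i − b·x_i constant, A_{i,i} − a·x_i² of degree at most 1, and A_{i,j} + A_{j,i} − 2a·x_i x_j of degree at most 1 (i ≠ j), and set D = Σ_{1≤i,j≤d} A_{i,j} Δ_i ∇_j + Σ_{i=1}^d B_i Δ_i and λ_k = k(ka − a + b). If the numbers λ_0, λ_1, …, λ_n are pairwise distinct, then for every μ ∈ ℕ_0^d with |μ| ≤ n there exists a polynomial P_μ ∈ ℝ[x_1,…,x_d] such that P_μ − x^μ has total degree at most |μ| − 1 and D P_μ = λ_{|μ|} P_μ. -/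
open Finset MvPolynomial

/-- Substitution `x ↦ x + c` on multivariate polynomials. -/
noncomputable def pshift (d : ℕ) (c : Fin d → ℝ) (p : MvPolynomial (Fin d) ℝ) :
    MvPolynomial (Fin d) ℝ :=
  MvPolynomial.bind₁ (fun j => MvPolynomial.X j + MvPolynomial.C (c j)) p

/-- Forward difference `Δ_i p = p(x + e_i) − p(x)` on polynomials. -/
noncomputable def fdiff (d : ℕ) (i : Fin d) (p : MvPolynomial (Fin d) ℝ) :
    MvPolynomial (Fin d) ℝ :=
  pshift d (fun j => if j = i then 1 else 0) p - p

/-- Backward difference `∇_i p = p(x) − p(x − e_i)` on polynomials. -/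
noncomputable def bdiff (d : ℕ) (i : Fin d) (p : MvPolynomial (Fin d) ℝ) :
    MvPolynomial (Fin d) ℝ :=
  p - pshift d (fun j => if j = i then -1 else 0) p

/-- The difference operator `D = Σ A_{i,j} Δ_i ∇_j + Σ B_i Δ_i` on polynomials. -/
noncomputable def Dpoly (d : ℕ) (A : Fin d → Fin d → MvPolynomial (Fin d) ℝ)
    (B : Fin d → MvPolynomial (Fin d) ℝ) (p : MvPolynomial (Fin d) ℝ) :
    MvPolynomial (Fin d) ℝ :=
  (∑ i, ∑ j, A i j * fdiff d i (bdiff d j p)) + ∑ i, B i * fdiff d i p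

/-- Polynomials all of whose monomials have degree at most the integer `k`;
this is the zero submodule for negative `k`. -/
noncomputable def degLE (d : ℕ) (k : ℤ) : Submodule ℝ (MvPolynomial (Fin d) ℝ) :=
  restrictSupport ℝ {m | (m.degree : ℤ) ≤ k}

lemma mem_degLE {d : ℕ} {k : ℤ} {p : MvPolynomial (Fin d) ℝ} :
    p ∈ degLE d k ↔ ∀ m, coeff m p ≠ 0 → (m.degree : ℤ) ≤ k := by
  simp [degLE, mem_restrictSupport_iff, Set.subset_def]

lemma degLE_mono {d : ℕ} {k l : ℤ} (h : k ≤ l) : degLE d k ≤ degLE d l :=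
  fun _ hp => mem_degLE.2 fun m hm => (mem_degLE.1 hp m hm).trans h

lemma mem_degLE_natCast {d k : ℕ} {p : MvPolynomial (Fin d) ℝ} :
    p ∈ degLE d k ↔ p.totalDegree ≤ k := by
  rw [← mem_restrictTotalDegree, mem_degLE, restrictTotalDegree, mem_restrictSupport_iff]
  simp only [Set.subset_def, Finsupp.sum_fintype, Finsupp.degree_eq_sum, Nat.cast_le,
    Set.mem_ofPred_eq, mem_coe, mem_support_iff, ne_eq, implies_true]

lemma eq_zero_of_mem_degLE {d : ℕ} {k : ℤ} (hk : k < 0) {p : MvPolynomial (Fin d) ℝ}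
    (hp : p ∈ degLE d k) : p = 0 := by
  ext m
  by_contra h
  have := mem_degLE.1 hp m h
  omega

lemma monomial_mem_degLE {d : ℕ} {k : ℤ} {m : Fin d →₀ ℕ} (h : (m.degree : ℤ) ≤ k) (c : ℝ) :
    monomial m c ∈ degLE d k := by
  classical
  refine mem_degLE.2 fun m' hm' => ?_
  rw [coeff_monomial] at hm'
  have : m = m' := by
    by_contra hne
    exact hm' (if_neg hne)
  exact this ▸ h

lemma X_mem_degLE {d : ℕ} (i : Fin d) : X i ∈ degLE d 1 :=
  monomial_mem_degLE (by simp) 1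

lemma mul_mem_degLE {d : ℕ} {k l : ℤ} {p q : MvPolynomial (Fin d) ℝ}
    (hp : p ∈ degLE d k) (hq : q ∈ degLE d l) : p * q ∈ degLE d (k + l) := by
  classical
  refine mem_degLE.2 fun m hm => ?_
  obtain ⟨s, hs, t, ht, rfl⟩ := Finset.mem_add.1 (support_mul p q (mem_support_iff.2 hm))
  have h₁ := mem_degLE.1 hp s (mem_support_iff.1 hs)
  have h₂ := mem_degLE.1 hq t (mem_support_iff.1 ht)
  rw [map_add]
  push_cast
  omega

lemma C_mul_mem_degLE {d : ℕ} {k : ℤ} {p : MvPolynomial (Fin d) ℝ} (c : ℝ)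
    (hp : p ∈ degLE d k) : C c * p ∈ degLE d k := by
  rw [← smul_eq_C_mul]
  exact Submodule.smul_mem _ _ hp

lemma mem_degLE_of_mul_X_mem {d : ℕ} {k : ℤ} {p : MvPolynomial (Fin d) ℝ} {i : Fin d}
    (hp : p * X i ∈ degLE d k) : p ∈ degLE d (k - 1) := by
  refine mem_degLE.2 fun m hm => ?_
  have := mem_degLE.1 hp (m + Finsupp.single i 1) (by rwa [coeff_mul_X])
  simp only [map_add, Finsupp.degree_single] at this
  push_cast at this
  omega

lemma map_mem_degLE {d : ℕ} (L : MvPolynomial (Fin d) ℝ →ₗ[ℝ] MvPolynomial (Fin d) ℝ)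
    {k l : ℤ} (h : ∀ m : Fin d →₀ ℕ, (m.degree : ℤ) ≤ k → ∀ c, L (monomial m c) ∈ degLE d l)
    {p : MvPolynomial (Fin d) ℝ} (hp : p ∈ degLE d k) : L p ∈ degLE d l := by
  rw [p.as_sum, map_sum]
  exact Submodule.sum_mem _ fun m hm => h m (mem_degLE.1 hp m (mem_support_iff.1 hm)) _

lemma pderiv_mem_degLE {d : ℕ} {k : ℤ} (i : Fin d) {p : MvPolynomial (Fin d) ℝ}
    (hp : p ∈ degLE d k) : pderiv i p ∈ degLE d (k - 1) := by
  refine map_mem_degLE (pderiv i).toLinearMap (fun m hm c => ?_) hp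
  change pderiv i (monomial m c) ∈ _
  rw [pderiv_monomial]
  by_cases hi : m i = 0
  · simp [hi]
  · refine monomial_mem_degLE ?_ _
    have h : m - Finsupp.single i 1 + Finsupp.single i 1 = m :=
      tsub_add_cancel_of_le (by simpa using Nat.one_le_iff_ne_zero.2 hi)
    have h' := congrArg Finsupp.degree h
    simp only [map_add, Finsupp.degree_single] at h'
    omega

/-- Multiplication by `X i` composed with `∂/∂x_i`, summed over `i`. -/
noncomputable def euler (d : ℕ) (p : MvPolynomial (Fin d) ℝ) : MvPolynomial (Fin d) ℝ :=
  ∑ i, X i * pderiv i p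

lemma euler_monomial {d : ℕ} (m : Fin d →₀ ℕ) (c : ℝ) :
    euler d (monomial m c) = C (m.degree : ℝ) * monomial m c := by
  simp only [euler, X_mul_pderiv_monomial, ← Finset.sum_smul, Finsupp.degree_eq_sum,
    ← smul_eq_C_mul, Nat.cast_smul_eq_nsmul]

lemma euler_sub_mem_degLE {d : ℕ} {k : ℤ} {p : MvPolynomial (Fin d) ℝ}
    (hp : p ∈ degLE d k) : euler d p - C (k : ℝ) * p ∈ degLE d (k - 1) := by
  let L : MvPolynomial (Fin d) ℝ →ₗ[ℝ] MvPolynomial (Fin d) ℝ :=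
    ∑ i, LinearMap.mulLeft ℝ (X i) ∘ₗ (pderiv i).toLinearMap - (k : ℝ) • LinearMap.id
  have hL : ∀ q, L q = euler d q - C (k : ℝ) * q := fun q => by
    simp [L, euler, smul_eq_C_mul]
  rw [← hL]
  refine map_mem_degLE L (fun m hm c => ?_) hp
  rw [hL, euler_monomial, ← sub_mul, ← C_sub]
  rcases hm.lt_or_eq with h | h
  · exact C_mul_mem_degLE _ (monomial_mem_degLE (by omega) c)
  · simp [← h]

lemma euler_mem_degLE {d : ℕ} {k : ℤ} {p : MvPolynomial (Fin d) ℝ}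
    (hp : p ∈ degLE d k) : euler d p ∈ degLE d k :=
  Submodule.sum_mem _ fun i _ => by
    simpa using mul_mem_degLE (X_mem_degLE i) (pderiv_mem_degLE i hp)

lemma euler_euler {d : ℕ} (p : MvPolynomial (Fin d) ℝ) :
    euler d (euler d p) = ∑ i, ∑ j, X i * X j * pderiv i (pderiv j p) + euler d p := by
  simp only [euler]
  rw [← Finset.sum_add_distrib]
  refine Finset.sum_congr rfl fun i _ => ?_
  simp only [map_sum, Derivation.leibniz, pderiv_X, smul_eq_mul, Finset.sum_add_distrib,
    mul_add, Finset.mul_sum]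
  congr 1
  · exact Finset.sum_congr rfl fun j _ => by ring
  · rw [Finset.sum_eq_single i (fun j _ hj => by simp [hj]) (by simp)]
    simp

lemma sum_X_mul_X_mul_pderiv_sub_mem_degLE {d : ℕ} {k : ℤ} {p : MvPolynomial (Fin d) ℝ}
    (hp : p ∈ degLE d k) :
    ∑ i, ∑ j, X i * X j * pderiv i (pderiv j p) - C ((k : ℝ) * (k - 1)) * p
      ∈ degLE d (k - 1) := by
  have h₁ := euler_sub_mem_degLE (euler_mem_degLE hp)
  have h₂ := C_mul_mem_degLE ((k : ℝ) - 1) (euler_sub_mem_degLE hp)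
  have h₃ := euler_euler p
  convert Submodule.add_mem _ h₁ h₂ using 1
  rw [h₃]
  simp only [C_mul, C_sub, C_1]
  ring

lemma pshift_sub_mem_degLE {d : ℕ} (i : Fin d) (ε : ℝ) {k : ℤ} {p : MvPolynomial (Fin d) ℝ}
    (hp : p ∈ degLE d k) :
    pshift d (fun j => if j = i then ε else 0) p - p - C ε * pderiv i p ∈ degLE d (k - 2) := by
  set c : Fin d → ℝ := fun j => if j = i then ε else 0 with hc
  let L : MvPolynomial (Fin d) ℝ →ₗ[ℝ] MvPolynomial (Fin d) ℝ :=
    (bind₁ fun j => X j + C (c j)).toLinearMap - LinearMap.id - ε • (pderiv i).toLinearMap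
  have hL : ∀ q, L q = pshift d c q - q - C ε * pderiv i q := fun q => by
    simp [L, pshift, smul_eq_C_mul]
  rw [← hL]
  refine map_mem_degLE L (fun m hm r => ?_) hp
  have hm' := monomial_mem_degLE hm r
  clear hp hm
  generalize k = l at *
  revert l
  refine induction_on_monomial (motive := fun q => ∀ l : ℤ, q ∈ degLE d l → L q ∈ degLE d (l - 2))
    (fun r l _ => by simp [hL, pshift]) (fun q j ih l hl => ?_) m r
  have hq := mem_degLE_of_mul_X_mem hl
  have h₁ := mul_mem_degLE (ih _ hq) (X_mem_degLE j)
  have h₂ : pshift d c q - q ∈ degLE d (l - 2) := by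
    have h₃ := Submodule.add_mem _ (degLE_mono (by omega) (ih _ hq) : L q ∈ degLE d (l - 1 - 1))
      (C_mul_mem_degLE ε (pderiv_mem_degLE i hq))
    rw [hL, sub_add_cancel] at h₃
    exact degLE_mono (by omega) h₃
  convert Submodule.add_mem _ (degLE_mono (by omega) h₁) (C_mul_mem_degLE (c j) h₂) using 1
  rw [hL, hL]
  have hs : pshift d c (q * X j) = pshift d c q * (X j + C (c j)) := by simp [pshift]
  have hd : C ε * pderiv i (q * X j) = C ε * pderiv i q * X j + C (c j) * q := by
    rw [Derivation.leibniz, pderiv_X]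
    by_cases h : j = i
    · subst h
      simp [hc]
      ring
    · simp [hc, h]
      ring
  rw [hs, hd]
  ring

lemma fdiff_sub_mem_degLE {d : ℕ} (i : Fin d) {k : ℤ} {p : MvPolynomial (Fin d) ℝ}
    (hp : p ∈ degLE d k) : fdiff d i p - pderiv i p ∈ degLE d (k - 2) := by
  simpa [fdiff] using pshift_sub_mem_degLE i 1 hp

lemma bdiff_sub_mem_degLE {d : ℕ} (i : Fin d) {k : ℤ} {p : MvPolynomial (Fin d) ℝ}
    (hp : p ∈ degLE d k) : bdiff d i p - pderiv i p ∈ degLE d (k - 2) := by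
  convert Submodule.neg_mem _ (pshift_sub_mem_degLE i (-1) hp) using 1
  simp only [bdiff, C_neg, C_1]
  ring

lemma bdiff_mem_degLE {d : ℕ} (i : Fin d) {k : ℤ} {p : MvPolynomial (Fin d) ℝ}
    (hp : p ∈ degLE d k) : bdiff d i p ∈ degLE d (k - 1) := by
  simpa using Submodule.add_mem _ (degLE_mono (by omega) (bdiff_sub_mem_degLE i hp))
    (pderiv_mem_degLE i hp)

lemma fdiff_bdiff_sub_mem_degLE {d : ℕ} (i j : Fin d) {k : ℤ} {p : MvPolynomial (Fin d) ℝ}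
    (hp : p ∈ degLE d k) :
    fdiff d i (bdiff d j p) - pderiv i (pderiv j p) ∈ degLE d (k - 3) := by
  have h₁ := fdiff_sub_mem_degLE i (bdiff_mem_degLE j hp)
  have h₂ := pderiv_mem_degLE i (bdiff_sub_mem_degLE j hp)
  rw [map_sub] at h₂
  rw [← sub_add_sub_cancel _ (pderiv i (bdiff d j p))]
  exact add_mem (degLE_mono (by omega) h₁) (degLE_mono (by omega) h₂)

lemma pderiv_comm {d : ℕ} (i j : Fin d) (p : MvPolynomial (Fin d) ℝ) :
    pderiv i (pderiv j p) = pderiv j (pderiv i p) := by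
  let D : Fin d → Derivation ℝ (MvPolynomial (Fin d) ℝ) (MvPolynomial (Fin d) ℝ) := pderiv
  have h : ⁅D i, D j⁆ = 0 := by
    refine derivation_ext fun l => ?_
    simp [D, Derivation.commutator_apply, pderiv_X, Pi.single_apply, apply_ite]
  simpa [D, Derivation.commutator_apply, sub_eq_zero] using congrArg (fun E => E p) h

lemma sum_mul_pderiv_pderiv_sub_mem_degLE {d : ℕ} (a : ℝ)
    (A : Fin d → Fin d → MvPolynomial (Fin d) ℝ)
    (hA : ∀ i j, A i j + A j i - C (2 * a) * X i * X j ∈ degLE d 1)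
    {k : ℤ} {p : MvPolynomial (Fin d) ℝ} (hp : p ∈ degLE d k) :
    ∑ i, ∑ j, A i j * pderiv i (pderiv j p)
      - C a * ∑ i, ∑ j, X i * X j * pderiv i (pderiv j p) ∈ degLE d (k - 1) := by
  have hS : ∑ i, ∑ j, (A i j + A j i - C (2 * a) * X i * X j) * pderiv i (pderiv j p)
      ∈ degLE d (k - 1) :=
    Submodule.sum_mem _ fun i _ => Submodule.sum_mem _ fun j _ =>
      degLE_mono (by omega)
        (mul_mem_degLE (hA i j) (pderiv_mem_degLE i (pderiv_mem_degLE j hp)))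
  have hswap : ∑ i, ∑ j, A j i * pderiv i (pderiv j p)
      = ∑ i, ∑ j, A i j * pderiv i (pderiv j p) := by
    rw [Finset.sum_comm]
    refine Finset.sum_congr rfl fun i _ => Finset.sum_congr rfl fun j _ => ?_
    rw [pderiv_comm]
  convert C_mul_mem_degLE (1 / 2) hS using 1
  have h_half : (C (1 / 2) : MvPolynomial (Fin d) ℝ) * C 2 = 1 := by
    rw [← C_mul]
    norm_num
  have h_two : (C 2 : MvPolynomial (Fin d) ℝ) = 2 := map_ofNat C 2
  rw [h_two] at h_half
  simp only [sub_mul, add_mul, Finset.sum_add_distrib, Finset.sum_sub_distrib, hswap, C_mul,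
    h_two, mul_assoc, ← Finset.mul_sum]
  linear_combination (C a * ∑ i, X i * ∑ j, X j * pderiv i (pderiv j p)
    - ∑ i, ∑ j, A i j * pderiv i (pderiv j p)) * h_half

/-- `Dpoly` acts on polynomials of degree at most `k` as multiplication by `k (a k - a + b)`,
up to terms of lower degree. -/
lemma Dpoly_sub_mem_degLE {d : ℕ} (a b : ℝ)
    (A : Fin d → Fin d → MvPolynomial (Fin d) ℝ) (B : Fin d → MvPolynomial (Fin d) ℝ)
    (hA2 : ∀ i j, A i j ∈ degLE d 2) (hB1 : ∀ i, B i ∈ degLE d 1)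
    (hB : ∀ i, B i - C b * X i ∈ degLE d 0)
    (hA : ∀ i j, A i j + A j i - C (2 * a) * X i * X j ∈ degLE d 1)
    {k : ℤ} {p : MvPolynomial (Fin d) ℝ} (hp : p ∈ degLE d k) :
    Dpoly d A B p - C ((k : ℝ) * (a * k - a + b)) * p ∈ degLE d (k - 1) := by
  have h₁ : ∑ i, ∑ j, A i j * (fdiff d i (bdiff d j p) - pderiv i (pderiv j p))
      ∈ degLE d (k - 1) :=
    Submodule.sum_mem _ fun i _ => Submodule.sum_mem _ fun j _ =>
      degLE_mono (by omega) (mul_mem_degLE (hA2 i j) (fdiff_bdiff_sub_mem_degLE i j hp))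
  have h₂ := sum_mul_pderiv_pderiv_sub_mem_degLE a A hA hp
  have h₃ := C_mul_mem_degLE a (sum_X_mul_X_mul_pderiv_sub_mem_degLE hp)
  have h₄ : ∑ i, B i * (fdiff d i p - pderiv i p) ∈ degLE d (k - 1) :=
    Submodule.sum_mem _ fun i _ =>
      degLE_mono (by omega) (mul_mem_degLE (hB1 i) (fdiff_sub_mem_degLE i hp))
  have h₅ : ∑ i, (B i - C b * X i) * pderiv i p ∈ degLE d (k - 1) :=
    Submodule.sum_mem _ fun i _ =>
      degLE_mono (by omega) (mul_mem_degLE (hB i) (pderiv_mem_degLE i hp))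
  have h₆ := C_mul_mem_degLE b (euler_sub_mem_degLE hp)
  convert add_mem (add_mem (add_mem h₁ h₂) h₃) (add_mem (add_mem h₄ h₅) h₆) using 1
  simp only [Dpoly, euler, mul_sub, sub_mul, Finset.sum_sub_distrib, mul_assoc,
    ← Finset.mul_sum, C_mul, C_add, C_sub, C_1]
  ring

lemma Dpoly_add {d : ℕ} (A : Fin d → Fin d → MvPolynomial (Fin d) ℝ)
    (B : Fin d → MvPolynomial (Fin d) ℝ) (p q : MvPolynomial (Fin d) ℝ) :
    Dpoly d A B (p + q) = Dpoly d A B p + Dpoly d A B q := by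
  have hf : ∀ i (p q : MvPolynomial (Fin d) ℝ), fdiff d i (p + q) = fdiff d i p + fdiff d i q :=
    fun i p q => by simp only [fdiff, pshift, map_add]; ring
  have hb : ∀ i, bdiff d i (p + q) = bdiff d i p + bdiff d i q :=
    fun i => by simp only [bdiff, pshift, map_add]; ring
  simp only [Dpoly, hb, hf, mul_add, Finset.sum_add_distrib]
  ring

/-- An additive map acting on each graded piece below degree `k` as a scalar different from `c`,
modulo lower degree, takes every value in these degrees after subtracting `c`. -/
lemma exists_map_sub_C_mul_eq {d : ℕ}
    (T : MvPolynomial (Fin d) ℝ → MvPolynomial (Fin d) ℝ) (hT : ∀ p q, T (p + q) = T p + T q)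
    (ev : ℕ → ℝ)
    (hev : ∀ (k : ℕ) (p), p ∈ degLE d k → T p - C (ev k) * p ∈ degLE d ((k : ℤ) - 1))
    (c : ℝ) (k : ℕ) (hc : ∀ j < k, ev j ≠ c) (q : MvPolynomial (Fin d) ℝ)
    (hq : q ∈ degLE d ((k : ℤ) - 1)) :
    ∃ r ∈ degLE d ((k : ℤ) - 1), T r - C c * r = q := by
  induction k generalizing q with
  | zero =>
    refine ⟨0, zero_mem _, ?_⟩
    have h0 : T 0 = 0 := by simpa using hT 0 0
    simp [h0, eq_zero_of_mem_degLE (by simp) hq]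
  | succ k ih =>
    have hk : ((k + 1 : ℕ) : ℤ) - 1 = k := by push_cast; ring
    rw [hk] at hq ⊢
    have hne : ev k - c ≠ 0 := sub_ne_zero.2 (hc k k.lt_succ_self)
    set p := C (ev k - c)⁻¹ * q with hp
    have hp_mem : p ∈ degLE d k := C_mul_mem_degLE _ hq
    have hpq : (C (ev k) - C c) * p = q := by
      rw [hp, ← C_sub, ← mul_assoc, ← C_mul, mul_inv_cancel₀ hne, C_1, one_mul]
    obtain ⟨r, hr, hrq⟩ := ih (fun j hj => hc j (hj.trans k.lt_succ_self)) _
      (neg_mem (hev k p hp_mem))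
    refine ⟨p + r, add_mem hp_mem (degLE_mono (by omega) hr), ?_⟩
    rw [hT]
    linear_combination hrq + hpq

/-- Theorem 3.7 (converse direction): if the coefficients of `D` have the
special form (3.3) and the eigenvalues `λ_k = k(ka − a + b)` for `k ≤ n` are
pairwise distinct, then for every `μ` with `|μ| ≤ n` there is a polynomial
eigenfunction `P_μ = x^μ mod Π^d_{|μ|−1}` with eigenvalue `λ_{|μ|}`. -/
theorem exists_polynomial_eigenfunction (d : ℕ) (n : ℕ) (a b : ℝ)
    (A : Fin d → Fin d → MvPolynomial (Fin d) ℝ)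
    (B : Fin d → MvPolynomial (Fin d) ℝ)
    (hA2 : ∀ i j, (A i j).totalDegree ≤ 2)
    (hB1 : ∀ i, (B i).totalDegree ≤ 1)
    (hB : ∀ i, (B i - C b * X i).totalDegree = 0)
    (hAii : ∀ i, (A i i - C a * X i ^ 2).totalDegree ≤ 1)
    (hAij : ∀ i j, i ≠ j → (A i j + A j i - C (2 * a) * X i * X j).totalDegree ≤ 1)
    (hlam : ∀ k l : ℕ, k ≤ n → l ≤ n → k ≠ l →
        (k : ℝ) * ((k : ℝ) * a - a + b) ≠ (l : ℝ) * ((l : ℝ) * a - a + b)) :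
    ∀ μ : Fin d →₀ ℕ, (∑ i, μ i) ≤ n →
      ∃ P : MvPolynomial (Fin d) ℝ,
        (P - monomial μ (1 : ℝ)).totalDegree ≤ (∑ i, μ i) - 1 ∧
        Dpoly d A B P
          = C (((∑ i, μ i : ℕ) : ℝ) * (a * ((∑ i, μ i : ℕ) : ℝ) - a + b)) * P := by
  intro μ hμ
  have hA : ∀ i j, A i j + A j i - C (2 * a) * X i * X j ∈ degLE d ((1 : ℕ) : ℤ) := fun i j => by
    by_cases h : i = j
    · subst h
      have h₁ := mem_degLE_natCast.2 (hAii i)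
      convert add_mem h₁ h₁ using 1
      rw [two_mul, C_add]
      ring
    · exact mem_degLE_natCast.2 (hAij i j h)
  let ev : ℕ → ℝ := fun k => (k : ℝ) * (a * k - a + b)
  have hev : ∀ (k : ℕ) (p), p ∈ degLE d k →
      Dpoly d A B p - C (ev k) * p ∈ degLE d ((k : ℤ) - 1) := fun k p hp => by
    simpa [ev] using Dpoly_sub_mem_degLE a b A B (fun i j => mem_degLE_natCast.2 (hA2 i j))
      (fun i => mem_degLE_natCast.2 (hB1 i)) (fun i => mem_degLE_natCast.2 (hB i).le) hA hp
  set m := ∑ i, μ i with hm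
  have hμm : monomial μ (1 : ℝ) ∈ degLE d m :=
    monomial_mem_degLE (by rw [Finsupp.degree_eq_sum]) 1
  obtain ⟨r, hr, hrq⟩ := exists_map_sub_C_mul_eq (Dpoly d A B) (Dpoly_add A B) ev hev (ev m) m
    (fun j hj h => hlam j m (hj.le.trans hμ) hμ hj.ne (by simpa only [ev, mul_comm a] using h))
    _ (neg_mem (hev m _ hμm))
  refine ⟨monomial μ 1 + r, ?_, ?_⟩
  · rw [add_sub_cancel_left]
    exact mem_degLE_natCast.1 (degLE_mono (by omega) hr)
  · rw [Dpoly_add]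
    linear_combination hrq
end

section
/- Let α_1, α_2, α_3 ∈ ℝ with α_3 > 0 and α_1 > −1, α_2 > −1, and define R_n(x) = Σ_{k=0}^n [(−n)_k (n − α_3 + α_1 + α_2 + 1)_k / ((α_1+1)_k (α_2+1)_k)] · (−x)_k / k! and the weight W(x) = (α_1+1)_x (α_2+1)_x / (x! (α_3+1)_x) for x ∈ ℕ_0. Then for all n ≠ m with n + m < α_3 − α_1 − α_2 − 1, the function x ↦ R_n(x) R_m(x) W(x) is (absolutely) summable over ℕ_0 and Σ_{x=0}^∞ R_n(x) R_m(x) W(x) = 0. -/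
open Finset

/-- Pochhammer symbol `(a)_k = a(a+1)⋯(a+k−1)`. -/
noncomputable def poch (a : ℝ) (k : ℕ) : ℝ := ∏ i ∈ Finset.range k, (a + i)

/-- The polynomials `R_n` of (4.10). -/
noncomputable def Rpol (α₁ α₂ α₃ : ℝ) (n : ℕ) (x : ℝ) : ℝ :=
  ∑ k ∈ Finset.range (n + 1),
    poch (-(n : ℝ)) k * poch ((n : ℝ) - α₃ + α₁ + α₂ + 1) k
      / (poch (α₁ + 1) k * poch (α₂ + 1) k) * poch (-x) k / (Nat.factorial k : ℝ)

/-- The weight `W(x) = (α₁+1)_x (α₂+1)_x / (x! (α₃+1)_x)` on `ℕ₀`. -/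
noncomputable def Wt (α₁ α₂ α₃ : ℝ) (x : ℕ) : ℝ :=
  poch (α₁ + 1) x * poch (α₂ + 1) x / ((Nat.factorial x : ℝ) * poch (α₃ + 1) x)

open Filter Topology Asymptotics

lemma poch_zero (a : ℝ) : poch a 0 = 1 := by simp [poch]

lemma poch_succ (a : ℝ) (k : ℕ) : poch a (k + 1) = poch a k * (a + k) := by
  simp [poch, Finset.prod_range_succ]

lemma poch_succ' (a : ℝ) (k : ℕ) : poch a (k + 1) = a * poch (a + 1) k := by
  simp only [poch, Finset.prod_range_succ', Nat.cast_zero, add_zero, Nat.cast_succ]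
  rw [mul_comm]
  congr 1
  exact Finset.prod_congr rfl fun i _ => by ring

lemma poch_pos {a : ℝ} (ha : 0 < a) (k : ℕ) : 0 < poch a k :=
  Finset.prod_pos fun i _ => by positivity

/-- Forward difference of the falling-factorial basis. -/
lemma poch_neg_add_one (x : ℝ) (k : ℕ) :
    poch (-(x + 1)) (k + 1) = poch (-x) (k + 1) - (k + 1) * poch (-x) k := by
  rw [poch_succ', poch_succ, show -(x + 1) + 1 = -x by ring]
  ring

/-- Backward difference of the falling-factorial basis, multiplied by `x`. -/
lemma mul_poch_neg_sub_one (x : ℝ) (k : ℕ) :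
    x * poch (-(x - 1)) (k + 1) = x * poch (-x) (k + 1) - (k + 1) * poch (-x) (k + 1) := by
  have h := poch_neg_add_one (x - 1) k
  have hr := poch_succ' (-x) k
  rw [sub_add_cancel] at h
  rw [show -x + 1 = -(x - 1) by ring] at hr
  linear_combination -x * h + (k + 1) * hr

/-- The coefficient of `poch (-x) k` in `Rpol α₁ α₂ α₃ n x`. -/
noncomputable def Rcoeff (α₁ α₂ α₃ : ℝ) (n k : ℕ) : ℝ :=
  poch (-(n : ℝ)) k * poch ((n : ℝ) - α₃ + α₁ + α₂ + 1) k
    / (poch (α₁ + 1) k * poch (α₂ + 1) k) / (Nat.factorial k : ℝ)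

lemma Rpol_eq_sum (α₁ α₂ α₃ : ℝ) (n : ℕ) (x : ℝ) :
    Rpol α₁ α₂ α₃ n x = ∑ k ∈ Finset.range (n + 1), Rcoeff α₁ α₂ α₃ n k * poch (-x) k :=
  Finset.sum_congr rfl fun k _ => by rw [Rcoeff]; ring

lemma Rcoeff_succ {α₁ α₂ : ℝ} (α₃ : ℝ) (hα₁ : -1 < α₁) (hα₂ : -1 < α₂) (n k : ℕ) :
    (k + 1) * (α₁ + 1 + k) * (α₂ + 1 + k) * Rcoeff α₁ α₂ α₃ n (k + 1)
      = (k - n) * (n - α₃ + α₁ + α₂ + 1 + k) * Rcoeff α₁ α₂ α₃ n k := by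
  have ha : 0 < α₁ + 1 := by linarith
  have hb : 0 < α₂ + 1 := by linarith
  have h₁ := (poch_pos ha k).ne'
  have h₂ := (poch_pos hb k).ne'
  have h₃ : α₁ + 1 + k ≠ 0 := by positivity
  have h₄ : α₂ + 1 + k ≠ 0 := by positivity
  have h₅ : (Nat.factorial k : ℝ) ≠ 0 := by positivity
  have h₆ : (k : ℝ) + 1 ≠ 0 := by positivity
  simp only [Rcoeff, poch_succ, Nat.factorial_succ, Nat.cast_mul, Nat.cast_succ]
  field_simp
  ring

/-- The second-order difference equation satisfied by `Rpol`. -/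
lemma Rpol_difference_equation {α₁ α₂ : ℝ} (α₃ : ℝ) (hα₁ : -1 < α₁) (hα₂ : -1 < α₂)
    (n : ℕ) (x : ℝ) :
    (α₁ + 1 + x) * (α₂ + 1 + x) * (Rpol α₁ α₂ α₃ n (x + 1) - Rpol α₁ α₂ α₃ n x)
      - x * (x + α₃) * (Rpol α₁ α₂ α₃ n x - Rpol α₁ α₂ α₃ n (x - 1))
      = n * (n - α₃ + α₁ + α₂ + 1) * Rpol α₁ α₂ α₃ n x := by
  have key : ∀ N : ℕ,
      (α₁ + 1 + x) * (α₂ + 1 + x)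
        * (∑ k ∈ Finset.range (N + 1), Rcoeff α₁ α₂ α₃ n k * poch (-(x + 1)) k
          - ∑ k ∈ Finset.range (N + 1), Rcoeff α₁ α₂ α₃ n k * poch (-x) k)
        - x * (x + α₃)
        * (∑ k ∈ Finset.range (N + 1), Rcoeff α₁ α₂ α₃ n k * poch (-x) k
          - ∑ k ∈ Finset.range (N + 1), Rcoeff α₁ α₂ α₃ n k * poch (-(x - 1)) k)
        = n * (n - α₃ + α₁ + α₂ + 1)
            * ∑ k ∈ Finset.range (N + 1), Rcoeff α₁ α₂ α₃ n k * poch (-x) k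
          - (n - N) * (n - α₃ + α₁ + α₂ + 1 + N) * Rcoeff α₁ α₂ α₃ n N * poch (-x) N := by
    intro N
    induction N with
    | zero => simp [poch_zero]
    | succ N ih =>
      have h := mul_poch_neg_sub_one x N
      have hc := Rcoeff_succ α₃ hα₁ hα₂ n N
      have hp := poch_succ (-x) N
      simp only [Finset.sum_range_succ _ (N + 1), poch_neg_add_one, Nat.cast_succ] at ih ⊢
      rw [hp] at h ⊢
      linear_combination ih + (x + α₃) * Rcoeff α₁ α₂ α₃ n (N + 1) * h - poch (-x) N * hc
  simpa [Rpol_eq_sum] using key n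

lemma Wt_succ {α₁ α₂ α₃ : ℝ} (hα₃ : 0 < α₃) (x : ℕ) :
    Wt α₁ α₂ α₃ (x + 1) * ((x + 1) * (x + 1 + α₃))
      = Wt α₁ α₂ α₃ x * ((α₁ + 1 + x) * (α₂ + 1 + x)) := by
  have h₁ := (poch_pos (by linarith : 0 < α₃ + 1) x).ne'
  have h₂ : α₃ + 1 + x ≠ 0 := by positivity
  have h₃ : (Nat.factorial x : ℝ) ≠ 0 := by positivity
  have h₄ : (x : ℝ) + 1 ≠ 0 := by positivity
  simp only [Wt, poch_succ, Nat.factorial_succ, Nat.cast_mul, Nat.cast_succ]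
  field_simp
  ring

/-- Summation by parts: partial sums of the inner product reduce to a Casoratian. -/
lemma sum_Rpol_mul_Rpol {α₁ α₂ α₃ : ℝ} (hα₃ : 0 < α₃) (hα₁ : -1 < α₁) (hα₂ : -1 < α₂)
    (n m N : ℕ) :
    ((n : ℝ) - m) * (n + m - α₃ + α₁ + α₂ + 1) * ∑ x ∈ Finset.range (N + 1),
        Rpol α₁ α₂ α₃ n x * Rpol α₁ α₂ α₃ m x * Wt α₁ α₂ α₃ x
      = Wt α₁ α₂ α₃ N * ((α₁ + 1 + N) * (α₂ + 1 + N))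
        * ((Rpol α₁ α₂ α₃ n (N + 1) - Rpol α₁ α₂ α₃ n N) * Rpol α₁ α₂ α₃ m N
          - Rpol α₁ α₂ α₃ n N * (Rpol α₁ α₂ α₃ m (N + 1) - Rpol α₁ α₂ α₃ m N)) := by
  induction N with
  | zero =>
    have hn := Rpol_difference_equation α₃ hα₁ hα₂ n 0
    have hm := Rpol_difference_equation α₃ hα₁ hα₂ m 0
    simp only [zero_add, Finset.sum_range_one, Nat.cast_zero] at hn hm ⊢
    linear_combination Wt α₁ α₂ α₃ 0 * (Rpol α₁ α₂ α₃ n 0 * hm - Rpol α₁ α₂ α₃ m 0 * hn)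
  | succ N ih =>
    have hn := Rpol_difference_equation α₃ hα₁ hα₂ n (N + 1)
    have hm := Rpol_difference_equation α₃ hα₁ hα₂ m (N + 1)
    have hW := Wt_succ (α₁ := α₁) (α₂ := α₂) hα₃ N
    rw [add_sub_cancel_right] at hn hm
    rw [Finset.sum_range_succ, mul_add, ih, ← hW]
    push_cast
    linear_combination Wt α₁ α₂ α₃ (N + 1)
      * (Rpol α₁ α₂ α₃ n (N + 1) * hm - Rpol α₁ α₂ α₃ m (N + 1) * hn)

lemma isBigO_const_add_mul_natCast (c d : ℝ) :
    (fun x : ℕ => c + d * (x : ℝ)) =O[atTop] fun x : ℕ => (x : ℝ) := by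
  refine IsBigO.add ?_ (isBigO_const_mul_self d _ _)
  exact (isLittleO_const_left.2 <| Or.inr <|
    tendsto_norm_atTop_atTop.comp tendsto_natCast_atTop_atTop).isBigO

lemma poch_neg_isBigO (k : ℕ) :
    (fun x : ℕ => poch (-(x : ℝ)) k) =O[atTop] fun x : ℕ => (x : ℝ) ^ k := by
  induction k with
  | zero => simpa [poch_zero] using isBigO_refl (fun _ : ℕ => (1 : ℝ)) atTop
  | succ k ih =>
    simp only [poch_succ, pow_succ]
    refine ih.mul ?_
    simpa [add_comm] using isBigO_const_add_mul_natCast k (-1)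

lemma natCast_pow_isBigO {k n : ℕ} (h : k ≤ n) :
    (fun x : ℕ => (x : ℝ) ^ k) =O[atTop] fun x : ℕ => (x : ℝ) ^ n :=
  IsBigO.of_bound 1 <| by
    filter_upwards [eventually_ge_atTop 1] with x hx
    have hx' : (1 : ℝ) ≤ x := by exact_mod_cast hx
    simpa using pow_le_pow_right₀ hx' h

lemma Rpol_isBigO (α₁ α₂ α₃ : ℝ) (n : ℕ) :
    (fun x : ℕ => Rpol α₁ α₂ α₃ n x) =O[atTop] fun x : ℕ => (x : ℝ) ^ n := by
  simp only [Rpol_eq_sum]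
  refine IsBigO.fun_sum fun k hk => ((poch_neg_isBigO k).trans ?_).const_mul_left _
  exact natCast_pow_isBigO (Finset.mem_range_succ_iff.1 hk)

lemma mul_Rpol_sub_isBigO (α₁ α₂ α₃ : ℝ) (n : ℕ) :
    (fun x : ℕ => (x : ℝ) * (Rpol α₁ α₂ α₃ n (x + 1) - Rpol α₁ α₂ α₃ n x))
      =O[atTop] fun x : ℕ => (x : ℝ) ^ n := by
  simp only [Rpol_eq_sum, ← Finset.sum_sub_distrib, ← mul_sub, Finset.mul_sum]
  refine IsBigO.fun_sum fun k hk => ?_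
  simp only [mul_left_comm _ (Rcoeff α₁ α₂ α₃ n k)]
  refine IsBigO.const_mul_left (IsBigO.trans ?_
    (natCast_pow_isBigO (Finset.mem_range_succ_iff.1 hk))) _
  cases k with
  | zero => simpa only [poch_zero, sub_self, mul_zero] using
      (isBigO_zero _ _ : (fun _ : ℕ => (0 : ℝ)) =O[atTop] _)
  | succ k =>
    simp only [poch_neg_add_one, sub_sub_cancel_left, pow_succ']
    refine (isBigO_refl _ _).mul ?_
    simpa only [← neg_mul] using (poch_neg_isBigO k).const_mul_left (-((k : ℝ) + 1))

lemma poch_eq_div_GammaSeq {a : ℝ} (ha : 0 < a) {x : ℕ} (hx : x ≠ 0) :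
    poch a x = (x : ℝ) ^ a * (Nat.factorial x : ℝ) / (Real.GammaSeq a x * (a + x)) := by
  have h₁ : poch a x ≠ 0 := (poch_pos ha x).ne'
  have h₂ : a + x ≠ 0 := by positivity
  have h₃ : (x : ℝ) ^ a ≠ 0 := by positivity
  have h₄ : (Nat.factorial x : ℝ) ≠ 0 := by positivity
  have h : Real.GammaSeq a x = (x : ℝ) ^ a * (Nat.factorial x : ℝ) / (poch a x * (a + x)) := by
    rw [← poch_succ]; rfl
  rw [h]
  field_simp

lemma Wt_isBigO {α₁ α₂ α₃ : ℝ} (hα₃ : 0 < α₃) (hα₁ : -1 < α₁) (hα₂ : -1 < α₂) :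
    (fun x : ℕ => Wt α₁ α₂ α₃ x) =O[atTop] fun x : ℕ => (x : ℝ) ^ (α₁ + α₂ - α₃) := by
  have ha : 0 < α₁ + 1 := by linarith
  have hb : 0 < α₂ + 1 := by linarith
  have hd : 0 < α₃ + 1 := by linarith
  have hG : (fun x : ℕ => Real.GammaSeq (α₃ + 1) x
      / (Real.GammaSeq (α₁ + 1) x * Real.GammaSeq (α₂ + 1) x)) =O[atTop]
        fun _ : ℕ => (1 : ℝ) :=
    ((Real.GammaSeq_tendsto_Gamma _).div
      ((Real.GammaSeq_tendsto_Gamma _).mul (Real.GammaSeq_tendsto_Gamma _))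
      (mul_pos (Real.Gamma_pos_of_pos ha) (Real.Gamma_pos_of_pos hb)).ne').isBigO_one ℝ
  have hinv : ∀ c : ℝ, 0 < c →
      (fun x : ℕ => (c + (x : ℝ))⁻¹) =O[atTop] fun x : ℕ => (x : ℝ)⁻¹ := by
    intro c hc
    refine IsBigO.of_bound 1 ?_
    filter_upwards [eventually_gt_atTop 0] with x hx
    have hx' : (0 : ℝ) < x := by exact_mod_cast hx
    rw [one_mul, Real.norm_of_nonneg (by positivity), Real.norm_of_nonneg (by positivity)]
    exact inv_anti₀ hx' (by linarith)
  have hlin : (fun x : ℕ => α₃ + 1 + (x : ℝ)) =O[atTop] fun x : ℕ => (x : ℝ) := by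
    simpa using isBigO_const_add_mul_natCast (α₃ + 1) 1
  have hmain := ((isBigO_refl (fun x : ℕ => (x : ℝ) ^ (α₁ + 1 + (α₂ + 1) - (α₃ + 1))) atTop).mul
    hG).mul (hlin.mul ((hinv _ ha).mul (hinv _ hb)))
  refine hmain.congr' ?_ ?_
  · filter_upwards [eventually_ne_atTop 0] with x hx
    have hx' : (0 : ℝ) < x := by positivity
    have hGd : Real.GammaSeq (α₃ + 1) x ≠ 0 := by
      intro h0
      have := poch_pos hd x
      simp [poch_eq_div_GammaSeq hd hx, h0] at this
    have h₁ : α₁ + 1 + x ≠ 0 := by positivity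
    have h₂ : α₂ + 1 + x ≠ 0 := by positivity
    have h₃ : α₃ + 1 + x ≠ 0 := by positivity
    have h₄ : (Nat.factorial x : ℝ) ≠ 0 := by positivity
    have h₅ : (x : ℝ) ^ (α₃ + 1) ≠ 0 := by positivity
    rw [Wt, poch_eq_div_GammaSeq ha hx, poch_eq_div_GammaSeq hb hx, poch_eq_div_GammaSeq hd hx,
      Real.rpow_sub hx', Real.rpow_add hx']
    generalize (x : ℝ) ^ (α₁ + 1) = A
    generalize (x : ℝ) ^ (α₂ + 1) = B
    generalize (x : ℝ) ^ (α₃ + 1) = D at *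
    field_simp
  · filter_upwards [eventually_ne_atTop 0] with x hx
    have hx' : (0 : ℝ) < x := by positivity
    rw [show α₁ + α₂ - α₃ = (α₁ + 1 + (α₂ + 1) - (α₃ + 1)) - 1 by ring, Real.rpow_sub_one hx'.ne']
    field_simp

lemma Rpol_mul_Rpol_mul_Wt_isBigO {α₁ α₂ α₃ : ℝ} (hα₃ : 0 < α₃) (hα₁ : -1 < α₁)
    (hα₂ : -1 < α₂) (n m : ℕ) :
    (fun x : ℕ => Rpol α₁ α₂ α₃ n x * Rpol α₁ α₂ α₃ m x * Wt α₁ α₂ α₃ x)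
      =O[atTop] fun x : ℕ => (x : ℝ) ^ ((n : ℝ) + m + α₁ + α₂ - α₃) := by
  refine (((Rpol_isBigO α₁ α₂ α₃ n).mul (Rpol_isBigO α₁ α₂ α₃ m)).mul
    (Wt_isBigO hα₃ hα₁ hα₂)).congr' EventuallyEq.rfl ?_
  filter_upwards [eventually_ne_atTop 0] with x hx
  have hx' : (0 : ℝ) < x := by positivity
  rw [← Real.rpow_natCast, ← Real.rpow_natCast, ← Real.rpow_add hx', ← Real.rpow_add hx']
  congr 1
  ring

/-- Growth of the boundary term of the summation by parts. -/
lemma casoratian_isBigO {α₁ α₂ α₃ : ℝ} (hα₃ : 0 < α₃) (hα₁ : -1 < α₁) (hα₂ : -1 < α₂)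
    (n m : ℕ) :
    (fun N : ℕ => Wt α₁ α₂ α₃ N * ((α₁ + 1 + N) * (α₂ + 1 + N))
        * ((Rpol α₁ α₂ α₃ n (N + 1) - Rpol α₁ α₂ α₃ n N) * Rpol α₁ α₂ α₃ m N
          - Rpol α₁ α₂ α₃ n N * (Rpol α₁ α₂ α₃ m (N + 1) - Rpol α₁ α₂ α₃ m N)))
      =O[atTop] fun N : ℕ => (N : ℝ) ^ ((n : ℝ) + m + α₁ + α₂ - α₃ + 1) := by
  have hlin : ∀ c : ℝ, (fun x : ℕ => c + (x : ℝ)) =O[atTop] fun x : ℕ => (x : ℝ) := fun c => by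
    simpa using isBigO_const_add_mul_natCast c 1
  have hC := ((mul_Rpol_sub_isBigO α₁ α₂ α₃ n).mul (Rpol_isBigO α₁ α₂ α₃ m)).sub
    ((Rpol_isBigO α₁ α₂ α₃ n).mul (mul_Rpol_sub_isBigO α₁ α₂ α₃ m))
  have hmain := (((Wt_isBigO hα₃ hα₁ hα₂).mul ((hlin (α₁ + 1)).mul (hlin (α₂ + 1)))).mul hC).mul
    (isBigO_refl (fun x : ℕ => (x : ℝ)⁻¹) atTop)
  refine hmain.congr' ?_ ?_
  · filter_upwards [eventually_ne_atTop 0] with x hx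
    field_simp
  · filter_upwards [eventually_ne_atTop 0] with x hx
    have hx' : (0 : ℝ) < x := by positivity
    rw [Real.rpow_add_one hx'.ne', show (n : ℝ) + m + α₁ + α₂ - α₃ = α₁ + α₂ - α₃ + n + m by ring,
      Real.rpow_add_natCast hx'.ne', Real.rpow_add_natCast hx'.ne']
    field_simp

/-- Proposition 4.1 (orthogonality): for `n ≠ m` with
`n + m < α₃ − α₁ − α₂ − 1`, the series `Σ_x R_n(x) R_m(x) W(x)` converges
(absolutely) and equals `0`. -/
theorem Rpol_orthogonality (α₁ α₂ α₃ : ℝ)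
    (hα₃ : 0 < α₃) (hα₁ : -1 < α₁) (hα₂ : -1 < α₂)
    (n m : ℕ) (hnm : n ≠ m)
    (hconv : (n : ℝ) + (m : ℝ) < α₃ - α₁ - α₂ - 1) :
    Summable (fun x : ℕ => Rpol α₁ α₂ α₃ n x * Rpol α₁ α₂ α₃ m x * Wt α₁ α₂ α₃ x)
    ∧ ∑' x : ℕ, Rpol α₁ α₂ α₃ n x * Rpol α₁ α₂ α₃ m x * Wt α₁ α₂ α₃ x = 0 := by
  have hs : Summable (fun x : ℕ =>
      Rpol α₁ α₂ α₃ n x * Rpol α₁ α₂ α₃ m x * Wt α₁ α₂ α₃ x) :=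
    summable_of_isBigO_nat (Real.summable_nat_rpow.2 (by linarith))
      (Rpol_mul_Rpol_mul_Wt_isBigO hα₃ hα₁ hα₂ n m)
  refine ⟨hs, ?_⟩
  have hzero : Tendsto (fun N : ℕ => (N : ℝ) ^ ((n : ℝ) + m + α₁ + α₂ - α₃ + 1)) atTop (𝓝 0) := by
    have h := (tendsto_rpow_neg_atTop
      (y := -((n : ℝ) + m + α₁ + α₂ - α₃ + 1)) (by linarith)).comp
      (tendsto_natCast_atTop_atTop (R := ℝ))
    simpa only [neg_neg, Function.comp_def] using h
  have hlim := (casoratian_isBigO hα₃ hα₁ hα₂ n m).trans_tendsto hzero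
  simp only [← sum_Rpol_mul_Rpol hα₃ hα₁ hα₂ n m] at hlim
  have hsum := ((tendsto_add_atTop_iff_nat 1).2 hs.hasSum.tendsto_sum_nat).const_mul
    (((n : ℝ) - m) * (n + m - α₃ + α₁ + α₂ + 1))
  refine (mul_eq_zero.1 (tendsto_nhds_unique hsum hlim)).resolve_left (mul_ne_zero ?_ ?_)
  · exact sub_ne_zero.2 (by exact_mod_cast hnm)
  · exact ne_of_lt (by linarith)
end
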